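/- Let G be a graph with an odd number n ≥ 13 of vertices. Then mp(G) = 2n − 5 if and only if either (1) δ(G) = n − 2 and G ≠ K_n − e for any edge e, or (2) G = K_n − E(P_3), the complete graph minus the two edges of a path on three vertices. -/

import Mathlib

open SimpleGraph

/-- An almost-perfect matching: a matching covering all vertices except exactly one. -/
def SimpleGraph.Subgraph.IsAlmostPerfectMatching {V : Type*} {G : SimpleGraph V}
    (M : G.Subgraph) : Prop :=
  M.IsMatching ∧ ∃ v : V, M.verts = {v}ᶜ

/-- `G` has a perfect matching or an almost-perfect matching. -/
def SimpleGraph.HasGoodMatching {V : Type*} (G : SimpleGraph V) : Prop :=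
  (∃ M : G.Subgraph, M.IsPerfectMatching) ∨ (∃ M : G.Subgraph, M.IsAlmostPerfectMatching)

/-- The matching preclusion number of `G`. -/
noncomputable def SimpleGraph.mp {V : Type*} [Fintype V] (G : SimpleGraph V) : ℕ :=
  sInf { k | ∃ F : Finset (Sym2 V), ↑F ⊆ G.edgeSet ∧ F.card = k ∧
    ¬ (G.deleteEdges ↑F).HasGoodMatching }


/-- `H` with a universal vertex `none` added. -/
def coneGraph {V : Type*} (H : SimpleGraph V) : SimpleGraph (Option V) where
  Adj x y := x ≠ y ∧ ∀ a b, x = some a → y = some b → H.Adj a b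
  symm := ⟨fun _ _ h => ⟨h.1.symm, fun a b ha hb => (h.2 b a hb ha).symm⟩⟩
  loopless := ⟨fun _ h => h.1 rfl⟩

lemma cone_matching {V : Type*} (H : SimpleGraph V)
    (h : ∃ M : (coneGraph H).Subgraph, M.IsPerfectMatching) : H.HasGoodMatching := by
  obtain ⟨M, hM, hs⟩ := h
  obtain ⟨v', hv', hu⟩ := hM (hs none)
  have hne := (M.adj_sub hv').1
  obtain ⟨v, rfl⟩ : ∃ v, v' = some v := by
    cases v' with
    | none => exact absurd rfl hne
    | some v => exact ⟨v, rfl⟩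
  right
  refine ⟨⟨{v}ᶜ, fun a b => M.Adj (some a) (some b), ?_, ?_, ?_⟩, ?_, v, rfl⟩
  · intro a b hab
    exact (M.adj_sub hab).2 a b rfl rfl
  · intro a b hab
    simp only [Set.mem_compl_iff, Set.mem_singleton_iff]
    rintro rfl
    obtain ⟨w, hw, hw'⟩ := hM (hs (some a))
    have h1 := hw' _ hab
    have h2 := hw' _ hv'.symm
    simp [← h2] at h1
  · exact ⟨fun a b hab => M.adj_symm hab⟩
  · intro a ha
    simp only [Set.mem_compl_iff, Set.mem_singleton_iff] at ha
    obtain ⟨w, hw, hw'⟩ := hM (hs (some a))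
    cases w with
    | none => exact absurd (by simpa using hu _ hw.symm) ha
    | some b =>
      refine ⟨b, hw, fun c hc => ?_⟩
      simpa using hw' _ hc

lemma extract.{v} {V : Type v} [Fintype V] (H : SimpleGraph V) (hn : Odd (Fintype.card V))
    (hH : ¬ H.HasGoodMatching) :
    ∃ (S : Set V) (C : Type v) (comp : V → C) (O : Finset C), O.card = S.ncard + 3 ∧
      (∀ a b, a ∉ S → b ∉ S → H.Adj a b → comp a = comp b) ∧
      ∀ o ∈ O, Odd ({a | a ∉ S ∧ comp a = o} : Set V).ncard := by
  classical
  have h1 : ¬ ∃ M : (coneGraph H).Subgraph, M.IsPerfectMatching := fun h => hH (cone_matching H h)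
  rw [SimpleGraph.tutte] at h1
  push Not at h1
  obtain ⟨u, hu⟩ := h1
  unfold SimpleGraph.IsTutteViolator at hu
  have hpar := SimpleGraph.odd_ncard_oddComponents ((⊤ : (coneGraph H).Subgraph).deleteVerts u).coe
  have hcard : Nat.card ((⊤ : (coneGraph H).Subgraph).deleteVerts u).verts + u.ncard
      = Fintype.card V + 1 := by
    rw [Nat.card_coe_set_eq]
    have : ((⊤ : (coneGraph H).Subgraph).deleteVerts u).verts = uᶜ := by
      ext; simp
    rw [this, add_comm, Set.ncard_add_ncard_compl]
    simp
  have hadj : ∀ x y : ((⊤ : (coneGraph H).Subgraph).deleteVerts u).verts,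
      ((⊤ : (coneGraph H).Subgraph).deleteVerts u).coe.Adj x y ↔ (coneGraph H).Adj x.1 y.1 := by
    intro x y
    have hx := x.2
    have hy := y.2
    simp at hx hy
    simp [hx, hy]
  have hmem : ∀ x, x ∈ ((⊤ : (coneGraph H).Subgraph).deleteVerts u).verts ↔ x ∉ u := by
    intro x; simp
  generalize ((⊤ : (coneGraph H).Subgraph).deleteVerts u) = D at *
  have hc : u.ncard + 2 ≤ D.coe.oddComponents.ncard := by
    rcases hn with ⟨k, hk⟩
    by_contra hcon
    have h2 : D.coe.oddComponents.ncard = u.ncard + 1 := by omega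
    rw [h2] at hpar
    grind
  have hnone : none ∈ u := by
    by_contra hnone
    have hle : D.coe.oddComponents.ncard ≤ 1 := by
      rw [Set.ncard_le_one_iff]
      have key : ∀ c : D.coe.ConnectedComponent,
          c = D.coe.connectedComponentMk ⟨none, (hmem _).2 hnone⟩ := by
        intro c
        induction c using SimpleGraph.ConnectedComponent.ind with
        | _ x =>
          by_cases hx : x.1 = none
          · congr 1
            exact Subtype.ext hx
          · rw [SimpleGraph.ConnectedComponent.eq]
            apply SimpleGraph.Adj.reachable
            rw [hadj]
            exact ⟨hx, fun a b _ hb => by simp at hb⟩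
      intro a b _ _
      rw [key a, key b]
    omega
  have hS : ({a | some a ∈ u} : Set V).ncard + 1 = u.ncard := by
    have : u = insert none (some '' {a | some a ∈ u}) := by
      ext x
      cases x <;> simp [hnone]
    conv_rhs => rw [this]
    rw [Set.ncard_insert_of_notMem (by simp), Set.ncard_image_of_injective _ (Option.some_injective V)]
  obtain ⟨O, hO, hOc⟩ := Set.exists_subset_card_eq (s := D.coe.oddComponents)
    (n := ({a | some a ∈ u} : Set V).ncard + 3) (by omega)
  refine ⟨{a | some a ∈ u}, Option D.coe.ConnectedComponent,
    fun a => if h : some a ∈ u then none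
      else some (D.coe.connectedComponentMk ⟨some a, (hmem _).2 h⟩),
    O.toFinite.toFinset.image some, ?_, ?_, ?_⟩
  · rw [Finset.card_image_of_injective _ (Option.some_injective _), ← hOc,
      Set.ncard_eq_toFinset_card _ O.toFinite]
  · intro a b ha hb hab
    simp only [Set.mem_ofPred_eq] at ha hb
    simp only [ha, hb, dite_false, Option.some.injEq]
    rw [SimpleGraph.ConnectedComponent.eq]
    apply SimpleGraph.Adj.reachable
    rw [hadj]
    refine ⟨by simpa using hab.ne, ?_⟩
    simp
    exact hab
  · intro o ho
    simp only [Finset.mem_image, Set.Finite.mem_toFinset] at ho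
    obtain ⟨c, hcO, rfl⟩ := ho
    have hodd : Odd c.supp.ncard := hO hcO
    have himg : c.supp.ncard = ((fun x : D.verts => x.1) '' c.supp).ncard :=
      (Set.ncard_image_of_injective _ Subtype.val_injective).symm
    rw [himg] at hodd
    rw [← Set.ncard_image_of_injective _ (Option.some_injective V)]
    convert hodd using 2
    ext x
    constructor
    · rintro ⟨a, ⟨ha, hac⟩, rfl⟩
      simp only [Set.mem_ofPred_eq] at ha
      simp only [ha, dite_false, Option.some.injEq] at hac
      exact ⟨⟨some a, (hmem _).2 ha⟩, hac, rfl⟩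
    · rintro ⟨⟨y, hy⟩, hyc, rfl⟩
      have hyu := (hmem _).1 hy
      cases y with
      | none => exact absurd hnone hyu
      | some a =>
        refine ⟨a, ⟨hyu, ?_⟩, rfl⟩
        simp only [hyu, dite_false, Option.some.injEq]
        exact hyc

open Classical in
lemma twoE {V : Type*} [Fintype V] (K : SimpleGraph V) (R T : Finset V) (q : ℕ)
    (hd : Disjoint R T) (hR : ∀ w ∈ R, q ≤ (R.filter (K.Adj w)).card)
    (hT : ∀ w ∈ T, q ≤ (R.filter (K.Adj w)).card) :
    R.card * q + 2 * (T.card * q) ≤ 2 * K.edgeSet.ncard := by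
  have h0 : 2 * K.edgeSet.ncard = ∑ v, (Finset.univ.filter (K.Adj v)).card := by
    rw [Set.ncard_eq_toFinset_card', ← SimpleGraph.edgeFinset,
      ← K.sum_degrees_eq_twice_card_edges]
    refine Finset.sum_congr rfl fun v _ => ?_
    rw [← SimpleGraph.card_neighborFinset_eq_degree, SimpleGraph.neighborFinset_eq_filter]
  have h1 : ∑ v ∈ R, (T.filter (K.Adj v)).card = ∑ w ∈ T, (R.filter (K.Adj w)).card := by
    have := Finset.sum_card_bipartiteAbove_eq_sum_card_bipartiteBelow (s := R) (t := T) K.Adj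
    simp only [Finset.bipartiteAbove, Finset.bipartiteBelow] at this
    rw [this]
    simp only [K.adj_comm]
  have h2 : ∑ v ∈ R ∪ T, (Finset.univ.filter (K.Adj v)).card
      ≤ ∑ v, (Finset.univ.filter (K.Adj v)).card :=
    Finset.sum_le_sum_of_subset (Finset.subset_univ _)
  rw [Finset.sum_union hd] at h2
  have h3 : ∑ v ∈ R, ((R.filter (K.Adj v)).card + (T.filter (K.Adj v)).card)
      ≤ ∑ v ∈ R, (Finset.univ.filter (K.Adj v)).card := by
    refine Finset.sum_le_sum fun v _ => ?_
    rw [← Finset.card_union_of_disjoint (Finset.disjoint_filter_filter hd)]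
    apply Finset.card_le_card
    intro x; simp; tauto
  have h4 : ∑ w ∈ T, (R.filter (K.Adj w)).card ≤ ∑ v ∈ T, (Finset.univ.filter (K.Adj v)).card := by
    refine Finset.sum_le_sum fun v _ => Finset.card_le_card ?_
    intro x; simp
  have h5 : R.card * q ≤ ∑ w ∈ R, (R.filter (K.Adj w)).card := by
    simpa using Finset.card_nsmul_le_sum R _ q hR
  have h6 : T.card * q ≤ ∑ w ∈ T, (R.filter (K.Adj w)).card := by
    simpa using Finset.card_nsmul_le_sum T _ q hT
  rw [Finset.sum_add_distrib] at h3
  omega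

open Classical in
lemma repCount {V C : Type*} [Fintype V] (H : SimpleGraph V) (S : Set V) (comp : V → C)
    (hadj : ∀ a b, a ∉ S → b ∉ S → H.Adj a b → comp a = comp b)
    (R : Finset V) (hRS : ∀ r ∈ R, r ∉ S) (j q : ℕ) (hq : R.card = j + q)
    (hj : ∀ c, (R.filter (fun r => comp r = c)).card ≤ j) :
    R.card + S.ncard ≤ Fintype.card V ∧
    R.card * q + 2 * ((Fintype.card V - S.ncard - R.card) * q) ≤ 2 * Hᶜ.edgeSet.ncard := by
  have hS : S.ncard = S.toFinset.card := Set.ncard_eq_toFinset_card' S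
  have hdis : Disjoint R S.toFinset := by
    rw [Finset.disjoint_left]; intro a ha; simpa using hRS a ha
  have key : ∀ w, w ∉ S → q ≤ (R.filter (Hᶜ.Adj w)).card := by
    intro w hw
    have h1 := Finset.card_filter_add_card_filter_not (s := R) (fun r => comp r = comp w)
    have h2 := hj (comp w)
    have h3 : (R.filter (fun r => ¬ comp r = comp w)).card ≤ (R.filter (Hᶜ.Adj w)).card := by
      apply Finset.card_le_card
      intro x
      simp only [Finset.mem_filter, SimpleGraph.compl_adj]
      rintro ⟨hx, hc⟩
      refine ⟨hx, ?_, fun h => hc (hadj _ _ hw (hRS x hx) h).symm⟩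
      rintro rfl; exact hc rfl
    omega
  have hcu := Finset.card_union_of_disjoint hdis
  refine ⟨?_, ?_⟩
  · rw [hS, ← hcu]; exact Finset.card_le_univ _
  · have hT : ((R ∪ S.toFinset)ᶜ).card = Fintype.card V - S.ncard - R.card := by
      rw [Finset.card_compl, hcu, hS]; omega
    rw [← hT]
    refine twoE _ _ _ _ ?_ (fun w hw => ?_) (fun w hw => ?_)
    · rw [Finset.disjoint_left]; intro a ha; simp [ha]
    · convert key w (hRS w hw)
    · simp at hw
      convert key w hw.2

lemma main_H {V : Type*} [Fintype V] (H : SimpleGraph V) (hn : Odd (Fintype.card V))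
    (h13 : 13 ≤ Fintype.card V) (hH : ¬ H.HasGoodMatching) :
    (∃ u v, u ≠ v ∧ (∀ x, ¬ H.Adj u x) ∧ (∀ x, ¬ H.Adj v x)) ∨
    5 * Fintype.card V - 11 ≤ 2 * Hᶜ.edgeSet.ncard := by
  classical
  obtain ⟨S, C, comp, O, hO, hadj, hodd⟩ := extract H hn hH
  by_cases hs : S.ncard = 0
  · have hSe : S = ∅ := (Set.ncard_eq_zero).1 hs
    subst hSe
    simp only [Set.mem_empty_iff_false, not_false_eq_true, true_and, forall_const] at hadj hodd
    -- isolated vertex from singleton class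
    have hiso : ∀ o, ({a | comp a = o} : Set V).ncard = 1 →
        ∃ u, comp u = o ∧ ∀ x, ¬ H.Adj u x := by
      intro o ho
      obtain ⟨u, hu⟩ := Set.ncard_eq_one.1 ho
      have hu0 : comp u = o := by
        have : u ∈ ({a | comp a = o} : Set V) := by rw [hu]; rfl
        exact this
      refine ⟨u, hu0, fun x hx => ?_⟩
      have : x ∈ ({a | comp a = o} : Set V) := by
        show comp x = o
        rw [← hadj _ _ hx, hu0]
      rw [hu] at this
      exact hx.ne this.symm
    have hbig : ∀ o, ({a | comp a = o} : Set V).ncard ≠ 1 → Odd ({a | comp a = o} : Set V).ncard →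
        ∃ a b, a ≠ b ∧ comp a = o ∧ comp b = o := by
      intro o h1 h2
      have : 1 < ({a | comp a = o} : Set V).ncard := by
        rcases h2 with ⟨k, hk⟩; omega
      obtain ⟨a, b, ha, hb, hab⟩ := (Set.one_lt_ncard_iff).1 this
      exact ⟨a, b, hab, ha, hb⟩
    have hfin : ∀ o1 o2 o3, o1 ≠ o2 → o1 ≠ o3 → o2 ≠ o3 →
        (∃ a b, a ≠ b ∧ comp a = o1 ∧ comp b = o1) → (∃ a b, a ≠ b ∧ comp a = o2 ∧ comp b = o2) →
        (∃ a, comp a = o3) → 5 * Fintype.card V - 11 ≤ 2 * Hᶜ.edgeSet.ncard := by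
      rintro o1 o2 o3 h12 h13' h23 ⟨a, a', haa, ha, ha'⟩ ⟨b, b', hbb, hb, hb'⟩ ⟨c, hc⟩
      have hR : ({a, a', b, b', c} : Finset V).card = 5 := by
        have e1 : a ≠ b := by rintro rfl; exact h12 (ha.symm.trans hb)
        have e2 : a ≠ b' := by rintro rfl; exact h12 (ha.symm.trans hb')
        have e3 : a' ≠ b := by rintro rfl; exact h12 (ha'.symm.trans hb)
        have e4 : a' ≠ b' := by rintro rfl; exact h12 (ha'.symm.trans hb')
        have e5 : a ≠ c := by rintro rfl; exact h13' (ha.symm.trans hc)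
        have e6 : a' ≠ c := by rintro rfl; exact h13' (ha'.symm.trans hc)
        have e7 : b ≠ c := by rintro rfl; exact h23 (hb.symm.trans hc)
        have e8 : b' ≠ c := by rintro rfl; exact h23 (hb'.symm.trans hc)
        simp [*]
      have := repCount H ∅ comp (fun a b _ _ => hadj a b) {a, a', b, b', c} (by simp) 2 3 hR ?_
      · rw [hR] at this
        simp at this
        omega
      · intro d
        by_cases d1 : d = o1
        · subst d1
          refine (Finset.card_le_card (t := {a, a'}) ?_).trans Finset.card_le_two
          intro x; simp only [Finset.mem_filter, Finset.mem_insert, Finset.mem_singleton]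
          rintro ⟨rfl | rfl | rfl | rfl | rfl, hx⟩ <;> grind
        · by_cases d2 : d = o2
          · subst d2
            refine (Finset.card_le_card (t := {b, b'}) ?_).trans Finset.card_le_two
            intro x; simp only [Finset.mem_filter, Finset.mem_insert, Finset.mem_singleton]
            rintro ⟨rfl | rfl | rfl | rfl | rfl, hx⟩ <;> grind
          · refine (Finset.card_le_card (t := {c, c}) ?_).trans Finset.card_le_two
            intro x; simp only [Finset.mem_filter, Finset.mem_insert, Finset.mem_singleton]
            rintro ⟨rfl | rfl | rfl | rfl | rfl, hx⟩ <;> grind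
    have hne : ∀ o, Odd ({a | comp a = o} : Set V).ncard → ∃ a, comp a = o := by
      intro o h
      exact (Set.nonempty_of_ncard_ne_zero h.pos.ne')
    rw [hs] at hO
    obtain ⟨o1, o2, o3, h12, h13', h23, rfl⟩ := Finset.card_eq_three.1 hO
    have q1 := hodd o1 (by simp)
    have q2 := hodd o2 (by simp)
    have q3 := hodd o3 (by simp)
    have htwo : ∀ p q, p ≠ q → ({a | comp a = p} : Set V).ncard = 1 →
        ({a | comp a = q} : Set V).ncard = 1 →
        (∃ u v, u ≠ v ∧ (∀ x, ¬ H.Adj u x) ∧ (∀ x, ¬ H.Adj v x)) := by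
      intro p q hpq hp hq
      obtain ⟨u, hu, hu'⟩ := hiso p hp
      obtain ⟨v, hv, hv'⟩ := hiso q hq
      refine ⟨u, v, ?_, hu', hv'⟩
      rintro rfl; exact hpq (hu.symm.trans hv)
    by_cases c1 : ({a | comp a = o1} : Set V).ncard = 1
    · by_cases c2 : ({a | comp a = o2} : Set V).ncard = 1
      · exact Or.inl (htwo _ _ h12 c1 c2)
      · by_cases c3 : ({a | comp a = o3} : Set V).ncard = 1
        · exact Or.inl (htwo _ _ h13' c1 c3)
        · exact Or.inr (hfin o2 o3 o1 h23 h12.symm h13'.symm (hbig _ c2 q2) (hbig _ c3 q3) (hne _ q1))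
    · by_cases c2 : ({a | comp a = o2} : Set V).ncard = 1
      · by_cases c3 : ({a | comp a = o3} : Set V).ncard = 1
        · exact Or.inl (htwo _ _ h23 c2 c3)
        · exact Or.inr (hfin o1 o3 o2 h13' h12 h23.symm (hbig _ c1 q1) (hbig _ c3 q3) (hne _ q2))
      · exact Or.inr (hfin o1 o2 o3 h12 h13' h23 (hbig _ c1 q1) (hbig _ c2 q2) (hne _ q3))
  · right
    have hex : ∀ o : C, ∃ a, o ∈ O → a ∉ S ∧ comp a = o := by
      intro o
      by_cases ho : o ∈ O
      · obtain ⟨a, ha⟩ := Set.nonempty_of_ncard_ne_zero (hodd o ho).pos.ne'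
        exact ⟨a, fun _ => ha⟩
      · have : Nonempty V := Fintype.card_pos_iff.1 (by omega)
        exact ⟨Classical.arbitrary V, fun h => absurd h ho⟩
    choose f hf using hex
    have hinj : Set.InjOn f O := by
      intro x hx y hy hxy
      rw [← (hf x hx).2, ← (hf y hy).2, hxy]
    have hRc : (O.image f).card = S.ncard + 3 := by
      rw [Finset.card_image_of_injOn hinj, hO]
    have := repCount H S comp hadj (O.image f) ?_ 1 (S.ncard + 2) (by omega) ?_
    · obtain ⟨h1, h2⟩ := this
      rw [hRc] at h1 h2
      generalize S.ncard = s at *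
      obtain ⟨k, hk⟩ : ∃ k, Fintype.card V = 2 * s + 3 + k := ⟨_, (Nat.add_sub_of_le (by omega)).symm⟩
      have hk' : Fintype.card V - s - (s + 3) = k := by omega
      rw [hk'] at h2
      rw [hk] at h13 ⊢
      have h3 : 5 * (2 * s + 3 + k) ≤ (s + 3) * (s + 2) + 2 * (k * (s + 2)) + 11 := by
        by_cases h5 : 5 ≤ s
        · nlinarith [Nat.zero_le (k * (s - 5)), mul_le_mul h5 h5 (by omega) (by omega), Nat.mul_le_mul_left k h5, Nat.mul_le_mul_left s h5]
        · have : s = 1 ∨ s = 2 ∨ s = 3 ∨ s = 4 := by omega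
          rcases this with rfl | rfl | rfl | rfl <;> omega
      omega
    · intro r hr
      obtain ⟨o, ho, rfl⟩ := Finset.mem_image.1 hr
      exact (hf o ho).1
    · intro c
      rw [Finset.card_le_one]
      intro x hx y hy
      simp only [Finset.mem_filter, Finset.mem_image] at hx hy
      obtain ⟨⟨o, ho, rfl⟩, hx⟩ := hx
      obtain ⟨⟨o', ho', rfl⟩, hy⟩ := hy
      rw [(hf o ho).2] at hx
      rw [(hf o' ho').2] at hy
      rw [hx, hy]

/-- The edges of `G` meeting `{u, v}`. -/
def touchSet {V : Type*} (G : SimpleGraph V) (u v : V) : Set (Sym2 V) :=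
  G.incidenceSet u ∪ G.incidenceSet v

lemma touch_card {V : Type*} [Fintype V] (G : SimpleGraph V) {u v : V} (huv : u ≠ v) :
    (touchSet G u v).ncard + (touchSet Gᶜ u v).ncard + 3 = 2 * Fintype.card V := by
  classical
  have h1 : touchSet (⊤ : SimpleGraph V) u v = touchSet G u v ∪ touchSet Gᶜ u v := by
    ext e
    induction e using Sym2.ind with
    | _ x y =>
      simp only [touchSet, Set.mem_union, SimpleGraph.incidenceSet, Set.mem_sep_iff,
        SimpleGraph.mem_edgeSet, SimpleGraph.top_adj, SimpleGraph.compl_adj]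
      by_cases h : G.Adj x y
      · have := h.ne; tauto
      · tauto
  have h2 : Disjoint (touchSet G u v) (touchSet Gᶜ u v) := by
    rw [Set.disjoint_left]
    intro e
    induction e using Sym2.ind with
    | _ x y =>
      simp only [touchSet, Set.mem_union, SimpleGraph.incidenceSet, Set.mem_sep_iff,
        SimpleGraph.mem_edgeSet, SimpleGraph.compl_adj]
      tauto
  have h3 := Set.ncard_union_eq h2
  rw [← h1] at h3
  have h4 := Set.ncard_union_add_ncard_inter ((⊤ : SimpleGraph V).incidenceSet u)
    ((⊤ : SimpleGraph V).incidenceSet v)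
  rw [SimpleGraph.incidenceSet_inter_incidenceSet_of_adj (G := ⊤) (a := u) (b := v)
    (by simpa using huv)] at h4
  have h5 : ∀ w, ((⊤ : SimpleGraph V).incidenceSet w).ncard = Fintype.card V - 1 := by
    intro w
    rw [← Nat.card_coe_set_eq, Nat.card_eq_fintype_card, SimpleGraph.card_incidenceSet_eq_degree]
    simp
  rw [h5, h5, Set.ncard_singleton] at h4
  have h6 : 0 < Fintype.card V := Fintype.card_pos_iff.2 ⟨u⟩
  change (touchSet ⊤ u v).ncard + 1 = _ at h4
  have h7 : 1 < Fintype.card V := Fintype.one_lt_card_iff.2 ⟨u, v, huv⟩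
  omega

lemma no_good_of_isolated {V : Type*} (H : SimpleGraph V) {u v : V} (huv : u ≠ v)
    (hu : ∀ x, ¬ H.Adj u x) (hv : ∀ x, ¬ H.Adj v x) : ¬ H.HasGoodMatching := by
  rintro (⟨M, hM, hs⟩ | ⟨M, hM, w, hw⟩)
  · obtain ⟨x, hx, -⟩ := hM (hs u)
    exact hu x (M.adj_sub hx)
  · by_cases h : u = w
    · have : v ∈ M.verts := by rw [hw]; simpa using fun h' => huv (h.trans h'.symm)
      obtain ⟨x, hx, -⟩ := hM this
      exact hv x (M.adj_sub hx)
    · have : u ∈ M.verts := by rw [hw]; simpa using h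
      obtain ⟨x, hx, -⟩ := hM this
      exact hu x (M.adj_sub hx)

lemma touch_mem {V : Type*} [Fintype V] (G : SimpleGraph V) {u v : V} (huv : u ≠ v) :
    (touchSet G u v).ncard ∈ { k | ∃ F : Finset (Sym2 V), ↑F ⊆ G.edgeSet ∧ F.card = k ∧
    ¬ (G.deleteEdges ↑F).HasGoodMatching } := by
  classical
  refine ⟨(touchSet G u v).toFinset, ?_, (Set.ncard_eq_toFinset_card' _).symm, ?_⟩
  · rw [Set.coe_toFinset]
    rintro e (he | he) <;> exact he.1
  · rw [Set.coe_toFinset]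
    refine no_good_of_isolated _ huv ?_ ?_
    · intro x hx
      rw [SimpleGraph.deleteEdges_adj] at hx
      exact hx.2 (Or.inl ⟨hx.1, by simp⟩)
    · intro x hx
      rw [SimpleGraph.deleteEdges_adj] at hx
      exact hx.2 (Or.inr ⟨hx.1, by simp⟩)

lemma mp_le {V : Type*} [Fintype V] (G : SimpleGraph V) {u v : V} (huv : u ≠ v) :
    G.mp ≤ (touchSet G u v).ncard := Nat.sInf_le (touch_mem G huv)

lemma mp_lower {V : Type*} [Fintype V] (G : SimpleGraph V)
    (hn : Odd (Fintype.card V)) (h13 : 13 ≤ Fintype.card V) :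
    (∃ u v, u ≠ v ∧ (touchSet G u v).ncard ≤ G.mp) ∨
    5 * Fintype.card V - 11 ≤ 2 * (G.mp + Gᶜ.edgeSet.ncard) := by
  classical
  obtain ⟨u, v, huv⟩ := Fintype.one_lt_card_iff.1 (show 1 < Fintype.card V by omega)
  obtain ⟨F, hF, hFc, hg⟩ := Nat.sInf_mem ⟨_, touch_mem G huv⟩
  change F.card = G.mp at hFc
  rw [← hFc]
  rcases main_H _ hn h13 hg with ⟨u, v, huv, hu, hv⟩ | h
  · left
    refine ⟨u, v, huv, ?_⟩
    rw [← Set.ncard_coe_finset]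
    refine Set.ncard_le_ncard ?_ (Set.toFinite _)
    have aux : ∀ w, (∀ x, ¬ (G.deleteEdges (F : Set (Sym2 V))).Adj w x) →
        G.incidenceSet w ⊆ (F : Set (Sym2 V)) := by
      rintro w hw e ⟨he, hwe⟩
      obtain ⟨x, rfl⟩ := Sym2.mem_iff_exists.1 hwe
      by_contra hcon
      exact hw x (by rw [SimpleGraph.deleteEdges_adj]; exact ⟨he, hcon⟩)
    exact Set.union_subset (aux u hu) (aux v hv)
  · right
    refine h.trans (Nat.mul_le_mul_left 2 ?_)
    have hsub : (G.deleteEdges (F : Set (Sym2 V)))ᶜ.edgeSet ⊆ (F : Set (Sym2 V)) ∪ Gᶜ.edgeSet := by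
      intro e
      induction e using Sym2.ind with
      | _ x y =>
        simp only [SimpleGraph.mem_edgeSet, SimpleGraph.compl_adj, SimpleGraph.deleteEdges_adj,
          Set.mem_union]
        tauto
    refine (Set.ncard_le_ncard hsub (Set.toFinite _)).trans ?_
    refine (Set.ncard_union_le _ _).trans ?_
    rw [Set.ncard_coe_finset]

/-- If the complement has two edges then some `touchSet` contains both. -/
lemma exists_touch {V : Type*} [Fintype V] (G : SimpleGraph V) (h : 2 ≤ Gᶜ.edgeSet.ncard) :
    ∃ u v, u ≠ v ∧ 2 ≤ (touchSet Gᶜ u v).ncard := by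
  obtain ⟨e, f, he, hf, hef⟩ := (Set.one_lt_ncard_iff).1 (show 1 < Gᶜ.edgeSet.ncard by omega)
  have key : ∃ u v, u ≠ v ∧ u ∈ e ∧ v ∈ f := by
    induction e using Sym2.ind with
    | _ a b =>
      induction f using Sym2.ind with
      | _ c d =>
        by_cases hac : a = c
        · refine ⟨a, d, ?_, by simp, by simp⟩
          rw [hac]; exact (show Gᶜ.Adj c d from hf).ne
        · exact ⟨a, c, hac, by simp, by simp⟩
  obtain ⟨u, v, huv, hu, hv⟩ := key
  refine ⟨u, v, huv, ?_⟩
  exact (Set.one_lt_ncard_iff).2 ⟨e, f, Or.inl ⟨he, hu⟩, Or.inr ⟨hf, hv⟩, hef⟩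

lemma mp_eq_of {V : Type*} [Fintype V] (G : SimpleGraph V)
    (hn : Odd (Fintype.card V)) (h13 : 13 ≤ Fintype.card V)
    (h2 : 2 ≤ Gᶜ.edgeSet.ncard) (hle : 2 * Gᶜ.edgeSet.ncard ≤ Fintype.card V)
    (ht : ∀ u v, u ≠ v → (touchSet Gᶜ u v).ncard ≤ 2) :
    G.mp = 2 * Fintype.card V - 5 := by
  apply le_antisymm
  · obtain ⟨u, v, huv, h⟩ := exists_touch G h2
    have := mp_le G huv
    have := touch_card G huv
    omega
  · rcases mp_lower G hn h13 with ⟨u, v, huv, h⟩ | h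
    · have := touch_card G huv
      have := ht u v huv
      omega
    · obtain ⟨k, hk⟩ := hn
      omega

lemma compl_facts {V : Type*} [Fintype V] (G : SimpleGraph V)
    (hn : Odd (Fintype.card V)) (h13 : 13 ≤ Fintype.card V)
    (h : G.mp = 2 * Fintype.card V - 5) :
    2 ≤ Gᶜ.edgeSet.ncard ∧ ∀ u v, u ≠ v → (touchSet Gᶜ u v).ncard ≤ 2 := by
  constructor
  · by_contra hcon
    rcases mp_lower G hn h13 with ⟨u, v, huv, h'⟩ | h'
    · have h1 := touch_card G huv
      have h2 : (touchSet Gᶜ u v).ncard ≤ Gᶜ.edgeSet.ncard := by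
        refine Set.ncard_le_ncard ?_ (Set.toFinite _)
        rintro e (he | he) <;> exact he.1
      omega
    · omega
  · intro u v huv
    have := mp_le G huv
    have := touch_card G huv
    omega

lemma compl_edgeSet_top_deleteEdges {V : Type*} (s : Set (Sym2 V)) (hs : ∀ e ∈ s, ¬ e.IsDiag) :
    ((⊤ : SimpleGraph V).deleteEdges s)ᶜ.edgeSet = s := by
  ext e
  induction e using Sym2.ind with
  | _ x y =>
    simp only [SimpleGraph.mem_edgeSet, SimpleGraph.compl_adj, SimpleGraph.deleteEdges_adj,
      SimpleGraph.top_adj]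
    have := hs s(x, y)
    simp only [Sym2.mk_isDiag_iff] at this
    tauto

lemma eq_top_deleteEdges {V : Type*} (G : SimpleGraph V) :
    G = (⊤ : SimpleGraph V).deleteEdges Gᶜ.edgeSet := by
  ext x y
  simp only [SimpleGraph.mem_edgeSet, SimpleGraph.compl_adj, SimpleGraph.deleteEdges_adj,
      SimpleGraph.top_adj]
  constructor
  · intro h; exact ⟨h.ne, fun h' => h'.2 h⟩
  · tauto

theorem stmt13 {V : Type*} [Fintype V] (G : SimpleGraph V) [DecidableRel G.Adj]
    (hn : Odd (Fintype.card V)) (h13 : 13 ≤ Fintype.card V) :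
    G.mp = 2 * Fintype.card V - 5 ↔
      (G.minDegree = Fintype.card V - 2 ∧
        ¬ ∃ u v : V, u ≠ v ∧ G = (⊤ : SimpleGraph V).deleteEdges {s(u, v)}) ∨
      (∃ u v w : V, u ≠ v ∧ v ≠ w ∧ u ≠ w ∧
        G = (⊤ : SimpleGraph V).deleteEdges {s(u, v), s(v, w)}) := by
  classical
  have hinc : ∀ w, (Gᶜ.incidenceSet w).ncard + G.degree w + 1 = Fintype.card V := by
    intro w
    rw [← Nat.card_coe_set_eq, Nat.card_eq_fintype_card, SimpleGraph.card_incidenceSet_eq_degree,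
      SimpleGraph.degree_compl]
    have := G.degree_lt_card_verts w
    omega
  have : Nonempty V := Fintype.card_pos_iff.1 (by omega)
  constructor
  · intro h
    obtain ⟨h2, ht⟩ := compl_facts G hn h13 h
    by_cases hd : ∀ w, (Gᶜ.incidenceSet w).ncard ≤ 1
    · left
      refine ⟨le_antisymm ?_ ?_, ?_⟩
      · obtain ⟨e, he⟩ := Set.nonempty_of_ncard_ne_zero (show Gᶜ.edgeSet.ncard ≠ 0 by omega)
        induction e using Sym2.ind with
        | _ x y =>
          have h3 : 0 < (Gᶜ.incidenceSet x).ncard :=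
            (Set.ncard_pos (Set.toFinite _)).2 ⟨s(x, y), he, by simp⟩
          have h4 := G.minDegree_le_degree x
          have h5 := hinc x
          omega
      · apply G.le_minDegree_of_forall_le_degree
        intro w
        have := hd w
        have := hinc w
        omega
      · rintro ⟨u, v, huv, rfl⟩
        rw [compl_edgeSet_top_deleteEdges _ (by simpa using huv)] at h2
        simp at h2
    · right
      push Not at hd
      obtain ⟨v, hv⟩ := hd
      obtain ⟨e, f, he, hf, hef⟩ := (Set.one_lt_ncard_iff).1 hv
      obtain ⟨u, rfl⟩ := Sym2.mem_iff_exists.1 he.2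
      obtain ⟨w, rfl⟩ := Sym2.mem_iff_exists.1 hf.2
      have e1 : v ≠ u := (show Gᶜ.Adj v u from he.1).ne
      have e2 : v ≠ w := (show Gᶜ.Adj v w from hf.1).ne
      have e3 : u ≠ w := by rintro rfl; exact hef rfl
      refine ⟨u, v, w, e1.symm, e2, e3, ?_⟩
      have hE : Gᶜ.edgeSet = {s(u, v), s(v, w)} := by
        apply Set.Subset.antisymm
        · intro g hg
          have hx : ∃ x, v ≠ x ∧ x ∈ g := by
            induction g using Sym2.ind with
            | _ x y =>
              by_cases hvx : v = x
              · exact ⟨y, by rw [hvx]; exact (show Gᶜ.Adj x y from hg).ne, by simp⟩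
              · exact ⟨x, hvx, by simp⟩
          obtain ⟨x, hvx, hxg⟩ := hx
          have hsub : ({s(v, u), s(v, w)} : Set (Sym2 V)) ⊆ touchSet Gᶜ v x := by
            rintro _ (rfl | rfl)
            · exact Or.inl he
            · exact Or.inl hf
          have heq := Set.eq_of_subset_of_ncard_le hsub
            (by rw [Set.ncard_pair hef]; exact ht v x hvx) (Set.toFinite _)
          have hgm : g ∈ touchSet Gᶜ v x := Or.inr ⟨hg, hxg⟩
          rw [← heq, Sym2.eq_swap (a := v) (b := u)] at hgm
          exact hgm
        · rintro _ (rfl | rfl)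
          · rw [Sym2.eq_swap]; exact he.1
          · exact hf.1
      rw [← hE]
      exact eq_top_deleteEdges G
  · rintro (⟨hmin, hne⟩ | ⟨u, v, w, huv, hvw, huw, rfl⟩)
    · have hd : ∀ w, (Gᶜ.incidenceSet w).ncard ≤ 1 := by
        intro w
        have := G.minDegree_le_degree w
        have := hinc w
        omega
      apply mp_eq_of G hn h13
      · by_contra hcon
        obtain ⟨x, hx⟩ := G.exists_minimal_degree_vertex
        have h1 := hinc x
        obtain ⟨e, he⟩ := Set.nonempty_of_ncard_ne_zero
          (show (Gᶜ.incidenceSet x).ncard ≠ 0 by omega)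
        obtain ⟨y, rfl⟩ := Sym2.mem_iff_exists.1 he.2
        apply hne
        refine ⟨x, y, (show Gᶜ.Adj x y from he.1).ne, ?_⟩
        have heq : ({s(x, y)} : Set (Sym2 V)) = Gᶜ.edgeSet := by
          apply Set.eq_of_subset_of_ncard_le _ _ (Set.toFinite _)
          · simpa using he.1
          · rw [Set.ncard_singleton]; omega
        rw [heq]
        exact eq_top_deleteEdges G
      · have h0 : 2 * Gᶜ.edgeSet.ncard = ∑ v, Gᶜ.degree v := by
          rw [Set.ncard_eq_toFinset_card', ← SimpleGraph.edgeFinset,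
            ← Gᶜ.sum_degrees_eq_twice_card_edges]
        rw [h0]
        have h1 : ∑ v, Gᶜ.degree v ≤ ∑ v : V, 1 := by
          refine Finset.sum_le_sum fun v _ => ?_
          rw [← SimpleGraph.card_incidenceSet_eq_degree, ← Nat.card_eq_fintype_card,
            Nat.card_coe_set_eq]
          exact hd v
        simpa using h1
      · intro u v _
        refine (Set.ncard_union_le _ _).trans ?_
        have := hd u
        have := hd v
        omega
    · have hE : ((⊤ : SimpleGraph V).deleteEdges {s(u, v), s(v, w)})ᶜ.edgeSet
          = {s(u, v), s(v, w)} := by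
        apply compl_edgeSet_top_deleteEdges
        rintro _ (rfl | rfl) <;> simpa
      have hc : ({s(u, v), s(v, w)} : Set (Sym2 V)).ncard = 2 := by
        apply Set.ncard_pair
        simp [huv, huw]
      apply mp_eq_of _ hn h13
      · rw [hE, hc]
      · rw [hE, hc]; omega
      · intro a b _
        rw [← hc]
        conv_rhs => rw [← hE]
        refine Set.ncard_le_ncard ?_ (Set.toFinite _)
        rintro e (he | he) <;> exact he.1
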